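/- (Normal form.) For every formula ψ ∈ L^|~_S (not a sharpening statement) there exist k ≥ 1, standpoints s₁, …, s_k ∈ S, modal operators #¹, …, #^k each equal to □ or ◇, and formulas φ₁, …, φ_k ∈ L^|~ such that for every ranked standpoint structure M: M ⊩ ψ if and only if M ⊩ #¹_{s₁} φ₁ ∧ … ∧ #^k_{s_k} φ_k. -/

import Mathlib

/-- Boolean formulas over a set of atoms `P`. -/
inductive BForm (P : Type) : Type
  | atom : P → BForm P
  | fls  : BForm P
  | neg  : BForm P → BForm P
  | conj : BForm P → BForm P → BForm P

/-- Evaluation of a Boolean formula under a classical valuation `u : P → Bool`. -/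
def BForm.eval {P : Type} (u : P → Bool) : BForm P → Bool
  | .atom p => u p
  | .fls => false
  | .neg α => !(α.eval u)
  | .conj α β => α.eval u && β.eval u

/-- A ranked interpretation: `R : U → ℕ ∪ {∞}` satisfying convexity. -/
structure RankedInterp (P : Type) where
  rank : (P → Bool) → ℕ∞
  convex : ∀ u : P → Bool, rank u ≠ ⊤ → ∀ j : ℕ, (j : ℕ∞) < rank u →
    ∃ v : P → Bool, rank v = (j : ℕ∞)

/-- `R ⊩ α` iff every valuation of finite rank satisfies `α`. -/
def RankedInterp.satB {P : Type} (R : RankedInterp P) (α : BForm P) : Prop :=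
  ∀ u : P → Bool, R.rank u ≠ ⊤ → α.eval u = true

/-- `R ⊩ α |~ β` iff every `α`-valuation of minimal rank among `α`-valuations satisfies `β`. -/
def RankedInterp.satDI {P : Type} (R : RankedInterp P) (α β : BForm P) : Prop :=
  ∀ u : P → Bool, α.eval u = true →
    (∀ v : P → Bool, α.eval v = true → ¬ R.rank v < R.rank u) → β.eval u = true

/-- The propositional KLM language `L^|~` : φ ::= α | α |~ β | φ ∧ φ. -/
inductive KLM (P : Type) : Type
  | bool : BForm P → KLM P
  | di : BForm P → BForm P → KLM P
  | conj : KLM P → KLM P → KLM P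

/-- Satisfaction of KLM formulas by a ranked interpretation. -/
def RankedInterp.satKLM {P : Type} (R : RankedInterp P) : KLM P → Prop
  | .bool α => R.satB α
  | .di α β => R.satDI α β
  | .conj φ ψ => R.satKLM φ ∧ R.satKLM ψ

/-- The DRSL language `L^|~_S` (with sharpening statements included as formulas). -/
inductive DRSL (P S : Type) : Type
  | base : KLM P → DRSL P S
  | box : S → DRSL P S → DRSL P S
  | dia : S → DRSL P S → DRSL P S
  | conj : DRSL P S → DRSL P S → DRSL P S
  | sharp : S → S → DRSL P S

/-- A ranked standpoint structure over precisifications `W`, with universal standpoint `sstar`. -/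
structure RSS (P S : Type) (sstar : S) (W : Type) where
  wne : Nonempty W
  σ : S → Set W
  σne : ∀ s : S, (σ s).Nonempty
  σstar : σ sstar = Set.univ
  γ : W → RankedInterp P

/-- Satisfaction `M, π ⊩ ψ` at a precisification. -/
def RSS.sat {P S : Type} {sstar : S} {W : Type} (M : RSS P S sstar W) :
    W → DRSL P S → Prop
  | π, .base φ => (M.γ π).satKLM φ
  | _, .box s ψ => ∀ π' ∈ M.σ s, RSS.sat M π' ψ
  | _, .dia s ψ => ∃ π' ∈ M.σ s, RSS.sat M π' ψ
  | π, .conj ψ₁ ψ₂ => RSS.sat M π ψ₁ ∧ RSS.sat M π ψ₂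
  | _, .sharp s₁ s₂ => M.σ s₁ ⊆ M.σ s₂

/-- Global satisfaction `M ⊩ ψ`. -/
def RSS.gsat {P S : Type} {sstar : S} {W : Type} (M : RSS P S sstar W) (ψ : DRSL P S) : Prop :=
  ∀ π : W, M.sat π ψ

/-- `M` is a model of a knowledge base `K`. -/
def RSS.isModel {P S : Type} {sstar : S} {W : Type} (M : RSS P S sstar W)
    (K : Set (DRSL P S)) : Prop :=
  ∀ ξ ∈ K, M.gsat ξ

/-- A modal operator `#`, either `□` or `◇`. -/
inductive MOp : Type
  | box
  | dia

/-- Application `#_s ψ` of a modal operator. -/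
def MOp.app {P S : Type} : MOp → S → DRSL P S → DRSL P S
  | .box, s, ψ => .box s ψ
  | .dia, s, ψ => .dia s ψ

/-- Left-associated conjunction `ψ ∧ l₁ ∧ ... ∧ lₙ`. -/
def DRSL.chain {P S : Type} (ψ : DRSL P S) (l : List (DRSL P S)) : DRSL P S :=
  l.foldl DRSL.conj ψ

/-- Non-sharpening DRSL formulas: those produced by ψ ::= φ | □_s ψ | ◇_s ψ | ψ ∧ ψ. -/
def DRSL.nonSharp {P S : Type} : DRSL P S → Prop
  | .base _ => True
  | .box _ ψ => ψ.nonSharp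
  | .dia _ ψ => ψ.nonSharp
  | .conj ψ₁ ψ₂ => ψ₁.nonSharp ∧ ψ₂.nonSharp
  | .sharp _ _ => False

theorem MOp.sat_app_base_iff {P S : Type} {sstar : S} {W : Type} (M : RSS P S sstar W)
    (o : MOp) (s : S) (φ : KLM P) (π π' : W) :
    M.sat π (o.app s (.base φ)) ↔ M.sat π' (o.app s (.base φ)) := by
  cases o <;> simp only [MOp.app, RSS.sat]

theorem RSS.sat_chain_iff {P S : Type} {sstar : S} {W : Type} (M : RSS P S sstar W) (π : W)
    (ψ : DRSL P S) (l : List (DRSL P S)) :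
    M.sat π (ψ.chain l) ↔ M.sat π ψ ∧ ∀ χ ∈ l, M.sat π χ := by
  induction l generalizing ψ with
  | nil => simp [DRSL.chain]
  | cons χ l ih =>
    have := ih (ψ.conj χ)
    simp only [DRSL.chain, List.foldl_cons, RSS.sat] at this ⊢
    simp [this, and_assoc]

/-- Pointwise normal form: a formula of `L^|~` together with finitely many modal conjuncts. -/
theorem DRSL.exists_pointwise_normal_form {P S : Type} (sstar : S) (ψ : DRSL P S)
    (h : ψ.nonSharp) :
    ∃ (φ : KLM P) (l : List (MOp × S × KLM P)),
      ∀ (W : Type) (M : RSS P S sstar W) (π : W),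
        M.sat π ψ ↔ (M.γ π).satKLM φ ∧ ∀ x ∈ l, M.sat π (x.1.app x.2.1 (.base x.2.2)) := by
  have sat_top : ∀ R : RankedInterp P, R.satKLM (.bool (.neg .fls)) := by
    simp [RankedInterp.satKLM, RankedInterp.satB, BForm.eval]
  induction ψ with
  | base φ => exact ⟨φ, [], by simp [RSS.sat]⟩
  | box s ψ ih =>
    obtain ⟨φ, l, hl⟩ := ih h
    refine ⟨.bool (.neg .fls), (.box, s, φ) :: l, fun W M π => ?_⟩
    simp only [List.forall_mem_cons, sat_top, true_and, MOp.app, RSS.sat, hl]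
    obtain ⟨π₀, hπ₀⟩ := M.σne s
    constructor
    · exact fun H => ⟨fun π' hπ' => (H π' hπ').1,
        fun x hx => (MOp.sat_app_base_iff M _ _ _ _ _).1 ((H π₀ hπ₀).2 x hx)⟩
    · exact fun H π' hπ' => ⟨H.1 π' hπ',
        fun x hx => (MOp.sat_app_base_iff M _ _ _ _ _).1 (H.2 x hx)⟩
  | dia s ψ ih =>
    obtain ⟨φ, l, hl⟩ := ih h
    refine ⟨.bool (.neg .fls), (.dia, s, φ) :: l, fun W M π => ?_⟩
    simp only [List.forall_mem_cons, sat_top, true_and, MOp.app, RSS.sat, hl]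
    constructor
    · rintro ⟨π', hπ', H₁, H₂⟩
      exact ⟨⟨π', hπ', H₁⟩, fun x hx => (MOp.sat_app_base_iff M _ _ _ _ _).1 (H₂ x hx)⟩
    · rintro ⟨⟨π', hπ', H₁⟩, H₂⟩
      exact ⟨π', hπ', H₁, fun x hx => (MOp.sat_app_base_iff M _ _ _ _ _).1 (H₂ x hx)⟩
  | conj ψ₁ ψ₂ ih₁ ih₂ =>
    obtain ⟨φ₁, l₁, hl₁⟩ := ih₁ h.1
    obtain ⟨φ₂, l₂, hl₂⟩ := ih₂ h.2
    refine ⟨.conj φ₁ φ₂, l₁ ++ l₂, fun W M π => ?_⟩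
    simp only [RSS.sat, RankedInterp.satKLM, List.forall_mem_append, hl₁, hl₂]
    tauto
  | sharp s₁ s₂ => exact h.elim

/-- Normal form: every non-sharpening DRSL formula `ψ` is equivalent, in every
ranked standpoint structure, to a conjunction `#¹_{s₁} φ₁ ∧ … ∧ #^k_{s_k} φ_k` with `k ≥ 1`
and `φᵢ ∈ L^|~`. -/
theorem normal_form_exists {P S : Type} (sstar : S) (ψ : DRSL P S) (h : ψ.nonSharp) :
    ∃ (hd : MOp × S × KLM P) (tl : List (MOp × S × KLM P)),
      ∀ (W : Type) (M : RSS P S sstar W),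
        M.gsat ψ ↔
          M.gsat ((hd.1.app hd.2.1 (.base hd.2.2)).chain
            (tl.map fun x => x.1.app x.2.1 (.base x.2.2))) := by
  obtain ⟨φ, l, hl⟩ := ψ.exists_pointwise_normal_form sstar h
  refine ⟨(.box, sstar, φ), l, fun W M => ?_⟩
  have := M.wne
  simp only [RSS.gsat, RSS.sat_chain_iff, hl, forall_and, List.forall_mem_map, MOp.app, RSS.sat,
    M.σstar, Set.mem_univ, forall_const]
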